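/- arXiv:1411.0437 — 2 statements merged into one kernel-verified Lean document; each statement's English description precedes it below -/
import Mathlib

section
/- Let n = M + N with M, N ≥ 1, and let γ be a real symmetric positive definite 2n×2n matrix satisfying γ·Ω_n·γ = Ω_n (the condition that γ is the covariance matrix of a pure Gaussian state). Write γ in block form [[γ_A, C], [Cᵀ, γ_B]] with γ_A of size 2M×2M and γ_B of size 2N×2N. Then det γ_A = det γ_B. -/
open Matrix ComplexOrder

/-- The `2N × 2N` symplectic form: the direct sum of `N` copies of `[[0,1],[-1,0]]`. -/
def Omega (N : ℕ) : Matrix (Fin (2 * N)) (Fin (2 * N)) ℝ :=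
  Matrix.of fun i j =>
    if i.val / 2 = j.val / 2 then
      if i.val % 2 = 0 ∧ j.val % 2 = 1 then 1
      else if i.val % 2 = 1 ∧ j.val % 2 = 0 then -1
      else 0
    else 0

/-- The complex matrix `S + i·Ω` obtained from real matrices `S` and `Ω`. -/
noncomputable def addI {n : Type*} (S Om : Matrix n n ℝ) : Matrix n n ℂ :=
  S.map (fun x => (x : ℂ)) + Complex.I • Om.map (fun x => (x : ℂ))

theorem Omega_mul_Omega (N : ℕ) : Omega N * Omega N = -1 := by
  ext i j
  have hi := i.isLt
  let k : Fin (2 * N) := ⟨2 * (i.val / 2) + (1 - i.val % 2), by omega⟩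
  have hk : k.val = 2 * (i.val / 2) + (1 - i.val % 2) := rfl
  rw [Matrix.mul_apply, Finset.sum_eq_single k]
  · simp only [Omega, Matrix.of_apply, Matrix.neg_apply, Matrix.one_apply, Fin.ext_iff, hk]
    split_ifs <;> first | omega | norm_num
  · intro l _ hl
    have hl' : l.val ≠ k.val := fun h => hl (Fin.ext h)
    rw [hk] at hl'
    have h0 : Omega N i l = 0 := by
      simp only [Omega, Matrix.of_apply]
      split_ifs <;> first | omega | rfl
    rw [h0, zero_mul]
  · simp

theorem det_Omega_ne_zero (N : ℕ) : (Omega N).det ≠ 0 := by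
  intro h
  have h2 := congrArg Matrix.det (Omega_mul_Omega N)
  rw [Matrix.det_mul, h, Matrix.det_neg] at h2
  simp at h2

/-- if `γ = [[γ_A, C],[Cᵀ, γ_B]]` is a symmetric positive definite
covariance matrix of a pure Gaussian state, i.e. `γ·Ω·γ = Ω` where
`Ω = Ω_M ⊕ Ω_N`, then the reduced determinants coincide: `det γ_A = det γ_B`. -/
theorem det_blocks_eq_of_pure (M N : ℕ) (hM : 1 ≤ M) (hN : 1 ≤ N)
    (γA : Matrix (Fin (2 * M)) (Fin (2 * M)) ℝ)
    (γB : Matrix (Fin (2 * N)) (Fin (2 * N)) ℝ)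
    (C : Matrix (Fin (2 * M)) (Fin (2 * N)) ℝ)
    (hpd : (Matrix.fromBlocks γA C Cᵀ γB).PosDef)
    (hsym : (Matrix.fromBlocks γA C Cᵀ γB).IsSymm)
    (hpure : Matrix.fromBlocks γA C Cᵀ γB *
        Matrix.fromBlocks (Omega M) 0 0 (Omega N) *
        Matrix.fromBlocks γA C Cᵀ γB =
        Matrix.fromBlocks (Omega M) 0 0 (Omega N)) :
    γA.det = γB.det := by
  have hΩM := det_Omega_ne_zero M
  have hΩN := det_Omega_ne_zero N
  have hdet : (Matrix.fromBlocks γA C Cᵀ γB).det = 1 := by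
    have h := congrArg Matrix.det hpure
    simp only [Matrix.det_mul, Matrix.det_fromBlocks_zero₁₂] at h
    have hpos := hpd.det_pos
    have hsq : (Matrix.fromBlocks γA C Cᵀ γB).det ^ 2 = 1 :=
      mul_right_cancel₀ (mul_ne_zero hΩM hΩN) (by linear_combination h)
    nlinarith
  simp only [Matrix.fromBlocks_multiply, Matrix.fromBlocks_inj, Matrix.mul_zero, zero_add,
    add_zero] at hpure
  obtain ⟨-, h₁₂, -, h₂₂⟩ := hpure
  have key : Matrix.fromBlocks γA C Cᵀ γB *
      Matrix.fromBlocks 1 (Omega M * C) 0 (Omega N * γB) =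
      Matrix.fromBlocks γA 0 Cᵀ (Omega N) := by
    simp only [Matrix.fromBlocks_multiply, Matrix.mul_one, Matrix.mul_zero, add_zero,
      ← Matrix.mul_assoc, h₁₂, h₂₂]
  have h := congrArg Matrix.det key
  rw [Matrix.det_mul, hdet, Matrix.det_fromBlocks_zero₂₁, Matrix.det_fromBlocks_zero₁₂,
    Matrix.det_mul, Matrix.det_one] at h
  exact mul_right_cancel₀ hΩN (by linear_combination -h)
end

section
/- Let M, N ≥ 1 and let γ be a real symmetric positive definite 2(M+1+N)×2(M+1+N) matrix such that the complex Hermitian matrix γ + i·Ω_{M+1+N} is positive semidefinite, with three diagonal blocks corresponding to subsystems A (first 2M rows/columns), B (next 2 rows/columns), and E (last 2N rows/columns). Let γ_{AB} and γ_{BE} denote the principal submatrices on A∪B and on B∪E respectively. Then it cannot happen that both γ_{AB} + i·(0_{2M} ⊕ Ω_1) fails to be positive semidefinite and γ_{BE} + i·(Ω_1 ⊕ 0_{2N}) fails to be positive semidefinite; i.e., Alice (A) and Eve (E) cannot simultaneously steer the single-mode system B by Gaussian measurements. -/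
open Matrix ComplexOrder

/-- The single-mode symplectic form `Ω_1 = [[0,1],[-1,0]]`. -/
def Om1 : Matrix (Fin 2) (Fin 2) ℝ := !![0, 1; -1, 0]

/-- Positive semidefiniteness of `S + i·Ω` in terms of real vectors. -/
theorem addI_posSemidef_iff {n : Type*} [Fintype n] {S Om : Matrix n n ℝ}
    (hS : S.IsSymm) (hOm : Omᵀ = -Om) :
    (addI S Om).PosSemidef ↔
      ∀ u v : n → ℝ, 2 * (u ⬝ᵥ Om *ᵥ v) ≤ u ⬝ᵥ S *ᵥ u + v ⬝ᵥ S *ᵥ v := by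
  have hS' (i j : n) : S j i = S i j := congr_fun₂ hS i j
  have hOm' (i j : n) : Om j i = -Om i j := congr_fun₂ hOm i j
  have hherm : (addI S Om).IsHermitian := by
    ext i j
    simp [addI, hS' i j, hOm' i j]
  have hform (x : n → ℂ) : (star x ⬝ᵥ addI S Om *ᵥ x).re =
      (fun i => (x i).re) ⬝ᵥ S *ᵥ (fun i => (x i).re) +
        (fun i => (x i).im) ⬝ᵥ S *ᵥ (fun i => (x i).im) -
        2 * ((fun i => (x i).re) ⬝ᵥ Om *ᵥ (fun i => (x i).im)) := by
    have hswap : ∑ i, ∑ j, (x i).im * (Om i j * (x j).re) =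
        -∑ i, ∑ j, (x i).re * (Om i j * (x j).im) := by
      rw [Finset.sum_comm]
      simp only [← Finset.sum_neg_distrib]
      refine Finset.sum_congr rfl fun i _ => Finset.sum_congr rfl fun j _ => ?_
      rw [hOm' i j]
      ring
    have hexp : (star x ⬝ᵥ addI S Om *ᵥ x).re =
        ∑ i, ∑ j, ((x i).re * (S i j * (x j).re) + (x i).im * (S i j * (x j).im)
          - (x i).re * (Om i j * (x j).im) + (x i).im * (Om i j * (x j).re)) := by
      simp only [dotProduct, mulVec, Finset.mul_sum, Complex.re_sum]
      refine Finset.sum_congr rfl fun i _ => Finset.sum_congr rfl fun j _ => ?_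
      simp [addI]
      ring
    rw [hexp]
    simp only [Finset.sum_add_distrib, Finset.sum_sub_distrib, hswap]
    simp only [dotProduct, mulVec, ← Finset.mul_sum]
    ring
  constructor
  · intro h u v
    have h0 := (Complex.le_def.1 (h.dotProduct_mulVec_nonneg fun i => ⟨u i, v i⟩)).1
    rw [hform] at h0
    simp only [Complex.zero_re] at h0
    linarith
  · intro h
    refine PosSemidef.of_dotProduct_mulVec_nonneg hherm fun x => ?_
    refine Complex.le_def.2 ⟨?_, (hherm.im_star_dotProduct_mulVec_self x).symm⟩
    rw [hform, Complex.zero_re]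
    linarith [h (fun i => (x i).re) (fun i => (x i).im)]

/-- If `Y = [[y₁, y₂], [y₂, y₃]]` is positive semidefinite and `Y ≤ X = [[x₁, x₂], [x₂, x₃]]`,
then `det Y ≤ det X`. -/
theorem det_two_le_det_two {x₁ x₂ x₃ y₁ y₂ y₃ : ℝ} (hy₁ : 0 ≤ y₁) (hy₃ : 0 ≤ y₃)
    (hy : y₂ ^ 2 ≤ y₁ * y₃)
    (h : ∀ a b : ℝ, y₁ * a ^ 2 + 2 * y₂ * a * b + y₃ * b ^ 2 ≤
      x₁ * a ^ 2 + 2 * x₂ * a * b + x₃ * b ^ 2) :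
    y₁ * y₃ - y₂ ^ 2 ≤ x₁ * x₃ - x₂ ^ 2 := by
  have hz₁ : 0 ≤ x₁ - y₁ := by linarith [h 1 0]
  have hz₃ : 0 ≤ x₃ - y₃ := by linarith [h 0 1]
  have hz : (x₂ - y₂) ^ 2 ≤ (x₁ - y₁) * (x₃ - y₃) := by
    have := discrim_le_zero (a := x₁ - y₁) (b := 2 * (x₂ - y₂)) (c := x₃ - y₃)
      fun a => by linarith [h a 1]
    rw [discrim] at this
    linarith
  have hcross : 2 * (y₂ * (x₂ - y₂)) ≤ y₁ * (x₃ - y₃) + y₃ * (x₁ - y₁) := by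
    refine le_of_sq_le_sq ?_ (by positivity)
    have hmul : (y₂ * (x₂ - y₂)) ^ 2 ≤ (y₁ * y₃) * ((x₁ - y₁) * (x₃ - y₃)) := by
      rw [mul_pow]
      exact mul_le_mul hy hz (sq_nonneg _) (by positivity)
    nlinarith [sq_nonneg (y₁ * (x₃ - y₃) - y₃ * (x₁ - y₁))]
  linarith

/-- For a positive semidefinite block matrix `[[P, -W], [-Wᵀ, Q]]` with `2 × 2` blocks and
`det P > 0`, `(det W)² ≤ det P * det Q`. -/
theorem sq_det_offDiag_le {p r q p' r' q' w₁₁ w₁₂ w₂₁ w₂₂ : ℝ}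
    (hp : 0 < p) (hD : 0 < p * q - r ^ 2)
    (h : ∀ s t a b : ℝ,
      2 * (s * (w₁₁ * a + w₁₂ * b) + t * (w₂₁ * a + w₂₂ * b)) ≤
        (p * s ^ 2 + 2 * r * s * t + q * t ^ 2) +
          (p' * a ^ 2 + 2 * r' * a * b + q' * b ^ 2)) :
    (w₁₁ * w₂₂ - w₁₂ * w₂₁) ^ 2 ≤ (p * q - r ^ 2) * (p' * q' - r' ^ 2) := by
  set D := p * q - r ^ 2 with hDdef
  have hadj (a b : ℝ) : 0 ≤ q * a ^ 2 - 2 * r * a * b + p * b ^ 2 := by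
    have : 0 ≤ p * (q * a ^ 2 - 2 * r * a * b + p * b ^ 2) := by
      have : p * (q * a ^ 2 - 2 * r * a * b + p * b ^ 2) = (p * b - r * a) ^ 2 + D * a ^ 2 := by
        rw [hDdef]; ring
      rw [this]; positivity
    exact nonneg_of_mul_nonneg_right this hp
  have hdet := det_two_le_det_two (x₁ := D * p') (x₂ := D * r') (x₃ := D * q')
    (y₁ := q * w₁₁ ^ 2 - 2 * r * w₁₁ * w₂₁ + p * w₂₁ ^ 2)
    (y₂ := q * w₁₁ * w₁₂ - r * (w₁₁ * w₂₂ + w₁₂ * w₂₁) + p * w₂₁ * w₂₂)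
    (y₃ := q * w₁₂ ^ 2 - 2 * r * w₁₂ * w₂₂ + p * w₂₂ ^ 2)
    (hadj _ _) (hadj _ _)
    (by
      have : 0 ≤ D * (w₁₁ * w₂₂ - w₁₂ * w₂₁) ^ 2 := by positivity
      rw [hDdef] at this
      linarith)
    (by
      intro a b
      have hR (m n : ℝ) (hmn : 2 * ((q * m - r * n) / D * m + (p * n - r * m) / D * n) ≤
          (p * ((q * m - r * n) / D) ^ 2 +
            2 * r * ((q * m - r * n) / D) * ((p * n - r * m) / D) +
            q * ((p * n - r * m) / D) ^ 2) + (p' * a ^ 2 + 2 * r' * a * b + q' * b ^ 2)) :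
          q * m ^ 2 - 2 * r * m * n + p * n ^ 2 ≤
            D * (p' * a ^ 2 + 2 * r' * a * b + q' * b ^ 2) := by
        have hlin : (q * m - r * n) / D * m + (p * n - r * m) / D * n =
            (q * m ^ 2 - 2 * r * m * n + p * n ^ 2) / D := by ring
        have hsq : p * ((q * m - r * n) / D) ^ 2 +
            2 * r * ((q * m - r * n) / D) * ((p * n - r * m) / D) +
            q * ((p * n - r * m) / D) ^ 2 =
            (q * m ^ 2 - 2 * r * m * n + p * n ^ 2) / D := by
          field_simp
          rw [hDdef]
          ring
        rw [hlin, hsq] at hmn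
        rw [← div_le_iff₀' hD]
        linarith
      have hab := hR _ _ (h _ _ a b)
      linarith)
  have hD2 : D * (w₁₁ * w₂₂ - w₁₂ * w₂₁) ^ 2 ≤ D * (D * (p' * q' - r' ^ 2)) := by
    rw [hDdef] at hdet ⊢
    linarith
  exact le_of_mul_le_mul_left hD2 hD

theorem omega_transpose (N : ℕ) : (Omega N)ᵀ = -Omega N := by
  ext i j
  change Omega N j i = -Omega N i j
  simp only [Omega, of_apply]
  split_ifs <;> first | omega | simp

theorem om1_transpose : Om1ᵀ = -Om1 := by
  ext i j
  fin_cases i <;> fin_cases j <;> simp [Om1]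

theorem dotProduct_om1_mulVec (b c : Fin 2 → ℝ) :
    b ⬝ᵥ Om1 *ᵥ c = b 0 * c 1 - b 1 * c 0 := by
  simp [Om1, dotProduct, mulVec, Fin.sum_univ_two]
  ring

/-- monogamy of Gaussian steering of a single mode. If `γ` is a
valid `(M+1+N)`-mode covariance matrix (`γ` symmetric positive definite with
`γ + i·Ω ≥ 0`), with parties `A` (first `2M` indices), `B` (next `2` indices),
`E` (last `2N` indices), then Alice and Eve cannot simultaneously steer the
single mode `B`: it cannot happen that both `γ_AB + i·(0_A ⊕ Ω_1)` and
`γ_BE + i·(Ω_1 ⊕ 0_E)` fail to be positive semidefinite. -/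
theorem monogamy_of_steering_single_mode (M N : ℕ) (hM : 1 ≤ M) (hN : 1 ≤ N)
    (γ : Matrix (Fin (2 * M) ⊕ (Fin 2 ⊕ Fin (2 * N)))
        (Fin (2 * M) ⊕ (Fin 2 ⊕ Fin (2 * N))) ℝ)
    (hpd : γ.PosDef) (hsym : γ.IsSymm)
    (hcov : (addI γ (Matrix.fromBlocks (Omega M) 0 0
        (Matrix.fromBlocks Om1 0 0 (Omega N)))).PosSemidef) :
    ¬ (¬ (addI (γ.submatrix (Sum.map id Sum.inl) (Sum.map id Sum.inl))
          (Matrix.fromBlocks 0 0 0 Om1)).PosSemidef ∧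
       ¬ (addI (γ.submatrix Sum.inr Sum.inr)
          (Matrix.fromBlocks Om1 0 0 0)).PosSemidef) := by
  rintro ⟨hA, hE⟩
  have hΩ : (fromBlocks (Omega M) 0 0 (fromBlocks Om1 0 0 (Omega N)))ᵀ =
      -fromBlocks (Omega M) 0 0 (fromBlocks Om1 0 0 (Omega N)) := by
    simp [fromBlocks_transpose, fromBlocks_neg, omega_transpose, om1_transpose]
  rw [addI_posSemidef_iff hsym hΩ] at hcov
  rw [addI_posSemidef_iff (hsym.submatrix _)
    (by simp [fromBlocks_transpose, fromBlocks_neg, om1_transpose])] at hA hE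
  push Not at hA hE
  obtain ⟨u, v, huv⟩ := hA
  obtain ⟨u', v', huv'⟩ := hE
  have hextA (x : Fin (2 * M) ⊕ Fin 2 → ℝ) :
      x ⬝ᵥ γ.submatrix (Sum.map id Sum.inl) (Sum.map id Sum.inl) *ᵥ x =
        Sum.elim (x ∘ Sum.inl) (Sum.elim (x ∘ Sum.inr) 0) ⬝ᵥ
          γ *ᵥ Sum.elim (x ∘ Sum.inl) (Sum.elim (x ∘ Sum.inr) 0) := by
    simp [dotProduct, mulVec, Fintype.sum_sum_type]
  have hextE (x : Fin 2 ⊕ Fin (2 * N) → ℝ) :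
      x ⬝ᵥ γ.submatrix Sum.inr Sum.inr *ᵥ x =
        Sum.elim 0 x ⬝ᵥ γ *ᵥ Sum.elim 0 x := by
    simp [dotProduct, mulVec, Fintype.sum_sum_type]
  rw [hextA, hextA] at huv
  rw [hextE, hextE] at huv'
  set U : Fin (2 * M) ⊕ (Fin 2 ⊕ Fin (2 * N)) → ℝ :=
    Sum.elim (u ∘ Sum.inl) (Sum.elim (u ∘ Sum.inr) 0) with hU
  set V : Fin (2 * M) ⊕ (Fin 2 ⊕ Fin (2 * N)) → ℝ :=
    Sum.elim (v ∘ Sum.inl) (Sum.elim (v ∘ Sum.inr) 0) with hV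
  set U' : Fin (2 * M) ⊕ (Fin 2 ⊕ Fin (2 * N)) → ℝ := Sum.elim 0 u' with hU'
  set V' : Fin (2 * M) ⊕ (Fin 2 ⊕ Fin (2 * N)) → ℝ := Sum.elim 0 v' with hV'
  have hquad (X Y : Fin (2 * M) ⊕ (Fin 2 ⊕ Fin (2 * N)) → ℝ) (s t : ℝ) :
      (s • X + t • Y) ⬝ᵥ γ *ᵥ (s • X + t • Y) =
        (X ⬝ᵥ γ *ᵥ X) * s ^ 2 + 2 * (X ⬝ᵥ γ *ᵥ Y) * s * t + (Y ⬝ᵥ γ *ᵥ Y) * t ^ 2 := by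
    have hcomm : Y ⬝ᵥ γ *ᵥ X = X ⬝ᵥ γ *ᵥ Y := by
      rw [dotProduct_mulVec, ← mulVec_transpose, hsym.eq, dotProduct_comm]
    simp only [mulVec_add, mulVec_smul, dotProduct_add, add_dotProduct, smul_dotProduct,
      dotProduct_smul, smul_eq_mul, hcomm]
    ring
  set d := u (.inr 0) * v (.inr 1) - u (.inr 1) * v (.inr 0) with hd
  set d' := u' (.inl 0) * v' (.inl 1) - u' (.inl 1) * v' (.inl 0) with hd'
  have hωA : u ⬝ᵥ fromBlocks 0 0 0 Om1 *ᵥ v = d := by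
    rw [← Sum.elim_comp_inl_inr u, ← Sum.elim_comp_inl_inr v, fromBlocks_mulVec,
      sumElim_dotProduct_sumElim]
    simp only [Sum.elim_comp_inl, Sum.elim_comp_inr, zero_mulVec, zero_add, dotProduct_zero,
      dotProduct_om1_mulVec, Function.comp_apply, hd]
  have hωE : u' ⬝ᵥ fromBlocks Om1 0 0 0 *ᵥ v' = d' := by
    rw [← Sum.elim_comp_inl_inr u', ← Sum.elim_comp_inl_inr v', fromBlocks_mulVec,
      sumElim_dotProduct_sumElim]
    simp only [Sum.elim_comp_inl, Sum.elim_comp_inr, zero_mulVec, add_zero, dotProduct_zero,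
      dotProduct_om1_mulVec, Function.comp_apply, hd']
  rw [hωA] at huv
  rw [hωE] at huv'
  have hnonneg (X) : 0 ≤ X ⬝ᵥ γ *ᵥ X := by
    simpa using hpd.posSemidef.dotProduct_mulVec_nonneg X
  have hdpos : 0 < d := by linarith [hnonneg U, hnonneg V]
  have hpos (s t : ℝ) (hst : s ≠ 0 ∨ t ≠ 0) :
      0 < (U ⬝ᵥ γ *ᵥ U) * s ^ 2 + 2 * (U ⬝ᵥ γ *ᵥ V) * s * t + (V ⬝ᵥ γ *ᵥ V) * t ^ 2 := by
    rw [← hquad]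
    refine hpd.dotProduct_mulVec_pos fun h0 => ?_
    have h₀ := congr_fun h0 (.inr (.inl 0))
    have h₁ := congr_fun h0 (.inr (.inl 1))
    simp only [hU, hV, Pi.smul_apply, Sum.elim_inr, Sum.elim_inl,
      Function.comp_apply, smul_eq_mul, Pi.zero_apply] at h₀ h₁
    have hs : s * d = 0 := by
      rw [hd]; linear_combination v (.inr 1) * h₀ - v (.inr 0) * h₁
    have ht : t * d = 0 := by
      rw [hd]; linear_combination u (.inr 0) * h₁ - u (.inr 1) * h₀
    rcases hst with hs' | ht'
    · exact mul_ne_zero hs' hdpos.ne' hs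
    · exact mul_ne_zero ht' hdpos.ne' ht
  have hp : 0 < U ⬝ᵥ γ *ᵥ U := by simpa using hpos 1 0 (by simp)
  have hD : 0 < (U ⬝ᵥ γ *ᵥ U) * (V ⬝ᵥ γ *ᵥ V) - (U ⬝ᵥ γ *ᵥ V) ^ 2 := by
    refine pos_of_mul_pos_right (a := U ⬝ᵥ γ *ᵥ U) ?_ hp.le
    linarith [hpos (-(U ⬝ᵥ γ *ᵥ V)) (U ⬝ᵥ γ *ᵥ U) (.inr hp.ne')]
  have key := sq_det_offDiag_le (p' := U' ⬝ᵥ γ *ᵥ U') (r' := U' ⬝ᵥ γ *ᵥ V')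
    (q' := V' ⬝ᵥ γ *ᵥ V')
    (w₁₁ := u (.inr 0) * u' (.inl 1) - u (.inr 1) * u' (.inl 0))
    (w₁₂ := u (.inr 0) * v' (.inl 1) - u (.inr 1) * v' (.inl 0))
    (w₂₁ := v (.inr 0) * u' (.inl 1) - v (.inr 1) * u' (.inl 0))
    (w₂₂ := v (.inr 0) * v' (.inl 1) - v (.inr 1) * v' (.inl 0)) hp hD
    (by
      intro s t a b
      rw [← hquad, ← hquad]
      refine le_of_eq_of_le ?_ (hcov (s • U + t • V) (a • U' + b • V'))
      have hB : (s • U + t • V) ⬝ᵥ fromBlocks (Omega M) 0 0 (fromBlocks Om1 0 0 (Omega N)) *ᵥ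
          (a • U' + b • V') =
          (s • u ∘ Sum.inr + t • v ∘ Sum.inr) ⬝ᵥ
            Om1 *ᵥ (a • u' ∘ Sum.inl + b • v' ∘ Sum.inl) := by
        have hl : s • U + t • V = Sum.elim (s • u ∘ Sum.inl + t • v ∘ Sum.inl)
            (Sum.elim (s • u ∘ Sum.inr + t • v ∘ Sum.inr) 0) := by
          ext (i | i | i) <;> simp [hU, hV]
        have hr : a • U' + b • V' = Sum.elim (0 : Fin (2 * M) → ℝ)
            (Sum.elim (a • u' ∘ Sum.inl + b • v' ∘ Sum.inl)
              (a • u' ∘ Sum.inr + b • v' ∘ Sum.inr)) := by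
          ext (i | i | i) <;> simp [hU', hV']
        rw [hl, hr]
        simp only [fromBlocks_mulVec, Sum.elim_comp_inl, Sum.elim_comp_inr,
          sumElim_dotProduct_sumElim, mulVec_zero, zero_mulVec, zero_add, add_zero,
          dotProduct_zero, zero_dotProduct]
      rw [hB, dotProduct_om1_mulVec]
      simp only [Pi.add_apply, Pi.smul_apply, Function.comp_apply, smul_eq_mul]
      ring)
  have hdet_lt {x y z e : ℝ} (hx : 0 ≤ x) (hy : 0 ≤ y) (h : x + y < 2 * e) :
      x * y - z ^ 2 < e ^ 2 := by
    nlinarith [sq_nonneg (x - y), sq_nonneg z]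
  have h₁ := hdet_lt (z := U ⬝ᵥ γ *ᵥ V) (hnonneg U) (hnonneg V) huv
  have h₂ := hdet_lt (z := U' ⬝ᵥ γ *ᵥ V') (hnonneg U') (hnonneg V') huv'
  have hlt := (mul_le_mul_of_nonneg_left h₂.le hD.le).trans_lt
    (mul_lt_mul_of_pos_right h₁ (by
      have : 0 < d' := by linarith [hnonneg U', hnonneg V']
      positivity))
  refine (key.trans_lt hlt).ne ?_
  rw [hd, hd']
  ring
end
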